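/- For any constants H0, m, M, g, L, s0 > 0, every twice continuously differentiable solution s of H0·s''(x) = (M + m·√(1 + s'(x)²))·g on [0,L] with s(0) = s(L) = s0 satisfies s(x) = s(L − x) for all x ∈ [0,L]. -/

import Mathlib

open Set

lemma sqrt_one_add_sq_le_add_abs_sub (a b : ℝ) :
    Real.sqrt (1 + a ^ 2) ≤ Real.sqrt (1 + b ^ 2) + |a - b| := by
  have hb : |b| ≤ Real.sqrt (1 + b ^ 2) := Real.abs_le_sqrt (by linarith)
  have hsq : Real.sqrt (1 + b ^ 2) ^ 2 = 1 + b ^ 2 := Real.sq_sqrt (by positivity)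
  have hmul : b * (a - b) ≤ |b| * |a - b| := by
    rw [← abs_mul]
    exact le_abs_self _
  refine Real.sqrt_le_iff.2 ⟨by positivity, ?_⟩
  nlinarith [mul_le_mul_of_nonneg_right hb (abs_nonneg (a - b)), sq_abs (a - b)]

lemma abs_sqrt_one_add_sq_sub_le (a b : ℝ) :
    |Real.sqrt (1 + a ^ 2) - Real.sqrt (1 + b ^ 2)| ≤ |a - b| := by
  have h₁ := sqrt_one_add_sq_le_add_abs_sub a b
  have h₂ := sqrt_one_add_sq_le_add_abs_sub b a
  rw [abs_sub_comm b a] at h₂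
  exact abs_le.2 ⟨by linarith, by linarith⟩

/-- A function on `[0, L]` with equal boundary values is symmetric about the midpoint if its
derivative solves an autonomous first-order equation with an even Lipschitz right-hand side. -/
lemma symmetric_of_deriv_autonomous {L : ℝ} (hL : 0 < L) {F : ℝ → ℝ} {K : NNReal}
    (hF : LipschitzWith K F) (hF_even : ∀ p, F (-p) = F p) {s v : ℝ → ℝ}
    (hs : ContinuousOn s (Icc 0 L)) (hsv : ∀ x ∈ Ioo 0 L, HasDerivAt s (v x) x)
    (hv : ∀ x ∈ Icc 0 L, HasDerivAt v (F (v x)) x) (hbc : s 0 = s L) :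
    ∀ x ∈ Icc 0 L, s x = s (L - x) := by
  have hrefl : MapsTo (fun x => L - x) (Icc 0 L) (Icc 0 L) := fun x hx =>
    ⟨sub_nonneg.2 hx.2, sub_le_self _ hx.1⟩
  have hd_cont : ContinuousOn (fun x => s x - s (L - x)) (Icc 0 L) :=
    hs.sub (hs.comp (by fun_prop) hrefl)
  have hd : ∀ x ∈ Ioo 0 L,
      HasDerivAt (fun x => s x - s (L - x)) (v x + v (L - x)) x := by
    intro x hx
    have h := (hsv (L - x) ⟨by linarith [hx.2], by linarith [hx.1]⟩).comp_const_sub L x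
    simpa using (hsv x hx).fun_sub h
  have hu : ∀ x ∈ Icc 0 L, HasDerivAt (fun x => -v (L - x)) (F (-v (L - x))) x := by
    intro x hx
    have h := ((hv (L - x) (hrefl hx)).comp_const_sub L x).fun_neg
    simpa [hF_even] using h
  obtain ⟨c, hc, hc0⟩ := exists_hasDerivAt_eq_zero hL hd_cont (by simp [hbc]) hd
  have huniq : EqOn v (fun x => -v (L - x)) (Icc 0 L) :=
    ODE_solution_unique_of_mem_Icc (v := fun _ => F) (s := fun _ => univ) (K := K)
      (fun _ _ => hF.lipschitzOnWith) hc
      (fun x hx => (hv x hx).continuousAt.continuousWithinAt)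
      (fun x hx => hv x (Ioo_subset_Icc_self hx)) (fun _ _ => mem_univ _)
      (fun x hx => (hu x hx).continuousAt.continuousWithinAt)
      (fun x hx => hu x (Ioo_subset_Icc_self hx)) (fun _ _ => mem_univ _)
      (eq_neg_of_add_eq_zero_left hc0)
  intro x hx
  rcases hx.1.eq_or_lt with rfl | hx0
  · simpa using hbc
  obtain ⟨y, hy, hslope⟩ := exists_hasDerivAt_eq_slope _ _ hx0
    (hd_cont.mono (Icc_subset_Icc_right hx.2)) fun y hy => hd y ⟨hy.1, hy.2.trans_le hx.2⟩
  have hy0 : v y + v (L - y) = 0 := by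
    have h : v y = -v (L - y) := huniq ⟨hy.1.le, hy.2.le.trans hx.2⟩
    rw [h, neg_add_cancel]
  rw [hy0, eq_comm, div_eq_zero_iff] at hslope
  rcases hslope with h | h
  · simp only [sub_zero, hbc, sub_self] at h
    exact sub_eq_zero.1 h
  · linarith

theorem cable_bvp_symmetric
    (H0 m M g L s0 : ℝ)
    (hH0 : 0 < H0) (hm : 0 < m) (hM : 0 < M) (hg : 0 < g) (hL : 0 < L) (hs0 : 0 < s0)
    (s : ℝ → ℝ)
    (hs : ContDiffOn ℝ 2 s (Icc 0 L))
    (hode : ∀ x ∈ Icc 0 L,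
      H0 * deriv (deriv s) x = (M + m * Real.sqrt (1 + (deriv s x) ^ 2)) * g)
    (hbc : s 0 = s0 ∧ s L = s0) :
    ∀ x ∈ Icc 0 L, s x = s (L - x) := by
  have hK : 0 ≤ m * g / H0 := by positivity
  have hF : LipschitzWith ⟨m * g / H0, hK⟩
      (fun p : ℝ => (M + m * Real.sqrt (1 + p ^ 2)) * g / H0) := by
    refine LipschitzWith.of_dist_le_mul fun a b => ?_
    have h : (M + m * Real.sqrt (1 + a ^ 2)) * g / H0 - (M + m * Real.sqrt (1 + b ^ 2)) * g / H0
        = m * g / H0 * (Real.sqrt (1 + a ^ 2) - Real.sqrt (1 + b ^ 2)) := by ring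
    rw [Real.dist_eq, Real.dist_eq, h, abs_mul, abs_of_nonneg hK]
    exact mul_le_mul_of_nonneg_left (abs_sqrt_one_add_sq_sub_le a b) hK
  refine symmetric_of_deriv_autonomous hL hF (fun p => by simp) hs.continuousOn
    (v := deriv s) (fun x hx => ?_) (fun x hx => ?_) (hbc.1.trans hbc.2.symm)
  · exact ((hs.contDiffAt (Icc_mem_nhds hx.1 hx.2)).differentiableAt (by norm_num)).hasDerivAt
  · have hderiv : deriv (deriv s) x = (M + m * Real.sqrt (1 + (deriv s x) ^ 2)) * g / H0 := by
      rw [eq_div_iff hH0.ne', mul_comm, hode x hx]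
    have hpos : 0 < (M + m * Real.sqrt (1 + (deriv s x) ^ 2)) * g / H0 := by positivity
    -- `deriv` takes the value `0` off the points of differentiability
    have hdiff : DifferentiableAt ℝ (deriv s) x :=
      differentiableAt_of_deriv_ne_zero (hderiv ▸ hpos.ne')
    simpa only [hderiv] using hdiff.hasDerivAt
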